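/- Let n ≥ 2 and let Ω ⊆ ℝ^n be a bounded open convex set with nonempty interior. Then λ(Ω) = ω_n^{-2/n} if and only if Ω is an open ball centered at the origin. -/

import Mathlib

open MeasureTheory Metric Set Real Bornology

noncomputable section

/-- Volume (Lebesgue measure) of a set in `ℝⁿ`. -/
def vol (n : ℕ) (Ω : Set (EuclideanSpace ℝ (Fin n))) : ℝ :=
  (volume Ω).toReal

/-- Surface area: the `(n-1)`-dimensional Hausdorff measure of the topological boundary. -/
def perim (n : ℕ) (Ω : Set (EuclideanSpace ℝ (Fin n))) : ℝ :=
  (μH[(n : ℝ) - 1] (frontier Ω)).toReal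

/-- Boundary momentum `W(Ω) = ∫_{∂Ω} |x|² dH^{n-1}(x)`. -/
def bmom (n : ℕ) (Ω : Set (EuclideanSpace ℝ (Fin n))) : ℝ :=
  ∫ x in frontier Ω, ‖x‖ ^ 2 ∂μH[(n : ℝ) - 1]

/-- The scale invariant functional `λ(Ω) = W(Ω) / (P(Ω) V(Ω)^{2/n})`. -/
def lamFun (n : ℕ) (Ω : Set (EuclideanSpace ℝ (Fin n))) : ℝ :=
  bmom n Ω / (perim n Ω * vol n Ω ^ ((2 : ℝ) / n))

/-- `ω_n`: the Lebesgue measure of the unit ball of `ℝⁿ`. -/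
def unitBallVol (n : ℕ) : ℝ :=
  (volume (ball (0 : EuclideanSpace ℝ (Fin n)) 1)).toReal

/-- On a compact space, two finite measures for which balls of equal radius have equal measure are
proportional (Christensen). -/
theorem measure_smul_eq_of_uniform_ball {X : Type*} [MetricSpace X] [CompactSpace X]
    [MeasurableSpace X] [BorelSpace X] (μ ν : Measure X) [IsFiniteMeasure μ] [IsFiniteMeasure ν]
    [ν.IsOpenPosMeasure]
    (hμ : ∀ x y r, μ.real (ball x r) = μ.real (ball y r))
    (hν : ∀ x y r, ν.real (ball x r) = ν.real (ball y r)) :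
    (ν univ) • μ = (μ univ) • ν := by
  have : IsFiniteMeasure ((ν univ) • μ) := ⟨by
    simpa using ENNReal.mul_lt_top (measure_lt_top _ _) (measure_lt_top _ _)⟩
  have : IsFiniteMeasure ((μ univ) • ν) := ⟨by
    simpa using ENNReal.mul_lt_top (measure_lt_top _ _) (measure_lt_top _ _)⟩
  apply ext_of_forall_integral_eq_of_IsFiniteMeasure
  intro f
  rw [integral_smul_measure, integral_smul_measure]
  change ν.real univ * _ = μ.real univ * _
  rcases isEmpty_or_nonempty X with hX | ⟨⟨x₀⟩⟩
  · simp [Measure.eq_zero_of_isEmpty μ, Measure.eq_zero_of_isEmpty ν]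
  refine eq_of_abs_sub_le_all fun ε hε ↦ ?_
  obtain ⟨δ, hδ, hf⟩ : ∃ δ > 0, ∀ x y : X, dist x y < δ →
      |f x - f y| ≤ ε / ((μ.real univ + 1) * (ν.real univ + 1)) := by
    have hε' : 0 < ε / ((μ.real univ + 1) * (ν.real univ + 1)) := by positivity
    obtain ⟨δ, hδ, h⟩ := Metric.uniformContinuous_iff.1
      (CompactSpace.uniformContinuous_of_continuous f.continuous) _ hε'
    exact ⟨δ, hδ, fun x y hxy ↦ (h hxy).le⟩
  set η := ε / ((μ.real univ + 1) * (ν.real univ + 1)) with hη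
  have hη0 : 0 ≤ η := by positivity
  have hD : IsOpen {p : X × X | dist p.1 p.2 < δ} :=
    isOpen_lt (by fun_prop) (by fun_prop)
  set D := {p : X × X | dist p.1 p.2 < δ} with hDdef
  have hint : ∀ h : X × X → ℝ, Continuous h →
      Integrable (D.indicator h) (μ.prod ν) := fun h hh ↦ by
    refine Integrable.indicator ?_ hD.measurableSet
    obtain ⟨C, hC⟩ := isCompact_univ.exists_bound_of_continuousOn hh.continuousOn
    exact Integrable.of_bound hh.aestronglyMeasurable C (.of_forall fun p ↦ hC p (mem_univ p))
  have hfst : ∫ p, D.indicator (fun p ↦ f p.1) p ∂μ.prod ν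
      = ν.real (ball x₀ δ) * ∫ x, f x ∂μ := by
    rw [integral_prod _ (hint _ (by fun_prop)), ← integral_const_mul]
    congr 1 with x
    have : (fun y ↦ D.indicator (fun p ↦ f p.1) (x, y))
        = (ball x δ).indicator fun _ ↦ f x := by
      ext y
      simp [indicator, hDdef, dist_comm]
    rw [this, integral_indicator measurableSet_ball, setIntegral_const, hν x x₀, smul_eq_mul]
  have hsnd : ∫ p, D.indicator (fun p ↦ f p.2) p ∂μ.prod ν
      = μ.real (ball x₀ δ) * ∫ x, f x ∂ν := by
    rw [integral_prod_symm _ (hint _ (by fun_prop)), ← integral_const_mul]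
    congr 1 with x
    have : (fun y ↦ D.indicator (fun p ↦ f p.2) (y, x))
        = (ball x δ).indicator fun _ ↦ f x := by
      ext y
      simp [indicator, hDdef]
    rw [this, integral_indicator measurableSet_ball, setIntegral_const, hμ x x₀, smul_eq_mul]
  have hone : (μ.prod ν).real D = ν.real (ball x₀ δ) * μ.real univ := by
    rw [← integral_indicator_one hD.measurableSet, integral_prod _ (hint _ (by fun_prop))]
    have : ∀ x, ∫ y, D.indicator 1 (x, y) ∂ν = ν.real (ball x₀ δ) := fun x ↦ by
      have : (fun y ↦ D.indicator (1 : X × X → ℝ) (x, y)) = (ball x δ).indicator 1 := by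
        ext y
        simp [indicator, hDdef, dist_comm]
      rw [this, integral_indicator_one measurableSet_ball, hν x x₀]
    simp [this, mul_comm]
  have hone' : (μ.prod ν).real D = μ.real (ball x₀ δ) * ν.real univ := by
    rw [← integral_indicator_one hD.measurableSet, integral_prod_symm _ (hint _ (by fun_prop))]
    have : ∀ x, ∫ y, D.indicator 1 (y, x) ∂μ = μ.real (ball x₀ δ) := fun x ↦ by
      have : (fun y ↦ D.indicator (1 : X × X → ℝ) (y, x)) = (ball x δ).indicator 1 := by
        ext y
        simp [indicator, hDdef]
      rw [this, integral_indicator_one measurableSet_ball, hμ x x₀]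
    simp [this, mul_comm]
  have hpos : 0 < ν.real (ball x₀ δ) := ENNReal.toReal_pos (measure_ball_pos ν x₀ hδ).ne' (measure_ne_top _ _)
  have hclose : |ν.real (ball x₀ δ) * ∫ x, f x ∂μ - μ.real (ball x₀ δ) * ∫ x, f x ∂ν|
      ≤ η * (ν.real (ball x₀ δ) * μ.real univ) := by
    rw [← hfst, ← hsnd, ← integral_sub (hint _ (by fun_prop)) (hint _ (by fun_prop)), ← hone]
    have : (fun p : X × X ↦ D.indicator (fun p ↦ f p.1) p - D.indicator (fun p ↦ f p.2) p)
        = D.indicator fun p : X × X ↦ f p.1 - f p.2 := by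
      ext p
      by_cases hp : p ∈ D <;> simp [hp]
    rw [this, integral_indicator hD.measurableSet]
    refine norm_setIntegral_le_of_norm_le_const (μ := μ.prod ν) (s := D)
      (f := fun p : X × X ↦ f p.1 - f p.2) (measure_lt_top _ _) fun p hp ↦ hf p.1 p.2 hp
  have hkey : ν.real (ball x₀ δ) * |ν.real univ * ∫ x, f x ∂μ - μ.real univ * ∫ x, f x ∂ν|
      ≤ ν.real (ball x₀ δ) * ε := by
    have e : ν.real (ball x₀ δ) * (ν.real univ * ∫ x, f x ∂μ - μ.real univ * ∫ x, f x ∂ν)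
      = ν.real univ * (ν.real (ball x₀ δ) * ∫ x, f x ∂μ - μ.real (ball x₀ δ) * ∫ x, f x ∂ν) := by
      linear_combination (∫ x, f x ∂ν) * hone - (∫ x, f x ∂ν) * hone'
    rw [← abs_of_pos hpos, ← abs_mul, e, abs_mul, abs_of_pos hpos,
      abs_of_nonneg measureReal_nonneg]
    have hε2 : η * (μ.real univ * ν.real univ) ≤ ε := by
      have h1 : η * ((μ.real univ + 1) * (ν.real univ + 1)) = ε := by
        rw [hη]; field_simp
      have h2 : 0 ≤ μ.real univ := measureReal_nonneg
      have h3 : 0 ≤ ν.real univ := measureReal_nonneg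
      nlinarith [mul_nonneg hη0 h2, mul_nonneg hη0 h3]
    calc _ ≤ ν.real univ * (η * (ν.real (ball x₀ δ) * μ.real univ)) := by gcongr
      _ = ν.real (ball x₀ δ) * (η * (μ.real univ * ν.real univ)) := by ring
      _ ≤ _ := by gcongr
  exact le_of_mul_le_mul_left hkey hpos

/-- If every point of `A ⊆ K` is the nearest point in `K` of some point of `B`, then the Hausdorff
measure of `A` is at most that of `B`. -/
theorem hausdorffMeasure_le_of_nearest {F : Type*} [NormedAddCommGroup F] [InnerProductSpace ℝ F]
    [MeasurableSpace F] [BorelSpace F] {d : ℝ} (hd : 0 ≤ d) {K A B : Set F} (hA : A ⊆ K)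
    (h : ∀ x ∈ A, ∃ y ∈ B, ∀ w ∈ K, inner ℝ (y - x) (w - x) ≤ 0) :
    μH[d] A ≤ μH[d] B := by
  choose! g hgB hg using h
  have hanti : ∀ x ∈ A, ∀ y ∈ A, dist x y ≤ dist (g x) (g y) := by
    intro x hx y hy
    have h1 := hg x hx y (hA hy)
    have h2 := hg y hy x (hA hx)
    have h3 : ‖x - y‖ ^ 2 ≤ inner ℝ (g x - g y) (x - y) := by
      rw [← real_inner_self_eq_norm_sq]
      simp only [inner_sub_left, inner_sub_right] at h1 h2 ⊢
      linarith
    have h4 := real_inner_le_norm (g x - g y) (x - y)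
    rw [dist_eq_norm, dist_eq_norm]
    by_contra! hlt
    nlinarith [norm_nonneg (g x - g y), norm_nonneg (x - y)]
  have hinj : InjOn g A := fun x hx y hy hxy ↦ by
    have := hanti x hx y hy
    rw [hxy, dist_self] at this
    exact dist_le_zero.1 this
  have hlip : LipschitzOnWith 1 (Function.invFunOn g A) (g '' A) := by
    refine LipschitzOnWith.of_dist_le_mul ?_
    rintro _ ⟨x, hx, rfl⟩ _ ⟨y, hy, rfl⟩
    rw [hinj.leftInvOn_invFunOn hx, hinj.leftInvOn_invFunOn hy]
    simpa using hanti x hx y hy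
  have himg : Function.invFunOn g A '' (g '' A) = A := hinj.leftInvOn_invFunOn.image_image
  calc μH[d] A = μH[d] (Function.invFunOn g A '' (g '' A)) := by rw [himg]
    _ ≤ μH[d] (g '' A) := by simpa using hlip.hausdorffMeasure_image_le hd
    _ ≤ μH[d] B := measure_mono (image_subset_iff.2 hgB)

section SphereMeasure

open scoped Pointwise

variable {m : ℕ}

local notation "𝔼" => EuclideanSpace ℝ (Fin (m + 1))

/-- Radial projection to the unit sphere is Lipschitz outside the unit ball. -/
theorem lipschitzOnWith_normalize {F : Type*} [NormedAddCommGroup F] [NormedSpace ℝ F] :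
    LipschitzOnWith 2 (fun x : F ↦ ‖x‖⁻¹ • x) {x | 1 ≤ ‖x‖} := by
  refine LipschitzOnWith.of_dist_le_mul fun x hx y hy ↦ ?_
  simp only [mem_ofPred_eq] at hx hy
  have hx0 : 0 < ‖x‖ := by linarith
  have hy0 : 0 < ‖y‖ := by linarith
  rw [dist_eq_norm, dist_eq_norm]
  have e : ‖x‖⁻¹ • x - ‖y‖⁻¹ • y = ‖x‖⁻¹ • ((x - y) + ((‖y‖ - ‖x‖) * ‖y‖⁻¹) • y) := by
    have : ‖x‖⁻¹ * ((‖y‖ - ‖x‖) * ‖y‖⁻¹) = ‖x‖⁻¹ - ‖y‖⁻¹ := by field_simp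
    rw [smul_add, smul_smul, this, smul_sub, sub_smul]
    abel
  rw [e, norm_smul, norm_inv, norm_norm]
  have h1 : ‖((‖y‖ - ‖x‖) * ‖y‖⁻¹) • y‖ ≤ ‖x - y‖ := by
    rw [norm_smul, norm_mul, norm_inv, norm_norm, mul_assoc, inv_mul_cancel₀ hy0.ne', mul_one,
      norm_sub_rev x y]
    exact abs_norm_sub_norm_le y x
  calc ‖x‖⁻¹ * ‖(x - y) + ((‖y‖ - ‖x‖) * ‖y‖⁻¹) • y‖
      ≤ 1 * (‖x - y‖ + ‖x - y‖) := by
        gcongr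
        · exact inv_le_one_of_one_le₀ hx
        · exact (norm_add_le _ _).trans (by gcongr)
    _ = _ := by push_cast; ring

theorem hausdorffMeasure_unitSphere_lt_top :
    μH[(m : ℝ)] (sphere (0 : 𝔼) 1) < ⊤ := by
  let φ : Fin (m + 1) → ℝ → (Fin m → ℝ) → 𝔼 :=
    fun i s y ↦ WithLp.toLp 2 (i.insertNth s y)
  let ψ : Fin (m + 1) → ℝ → (Fin m → ℝ) → 𝔼 :=
    fun i s y ↦ ‖φ i s y‖⁻¹ • φ i s y
  have hφ1 : ∀ i s y, |s| = 1 → 1 ≤ ‖φ i s y‖ := fun i s y hs ↦ by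
    have := PiLp.norm_apply_le (φ i s y) i
    simpa [φ, hs] using this
  have hφ : ∀ i s, ∃ C, LipschitzWith C (φ i s) := fun i s ↦ by
    have h1 : LipschitzWith 1 (fun y : Fin m → ℝ ↦ (i.insertNth s y : Fin (m + 1) → ℝ)) := by
      refine LipschitzWith.of_dist_le_mul fun y z ↦ ?_
      rw [NNReal.coe_one, one_mul]
      refine (dist_pi_le_iff dist_nonneg).2 fun j ↦ ?_
      refine Fin.succAboveCases i ?_ (fun k ↦ ?_) j
      · simp
      · simpa using dist_le_pi_dist y z k
    exact ⟨_, (PiLp.lipschitzWith_toLp 2 (fun _ : Fin (m + 1) ↦ ℝ)).comp h1⟩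
  have hψ : ∀ i s, |s| = 1 → μH[(m : ℝ)] (ψ i s '' closedBall 0 1) < ⊤ := fun i s hs ↦ by
    obtain ⟨C, hC⟩ := hφ i s
    have h2 : LipschitzOnWith (2 * C) (ψ i s) (closedBall 0 1) :=
      lipschitzOnWith_normalize.comp hC.lipschitzOnWith fun y _ ↦ hφ1 i s y hs
    refine (h2.hausdorffMeasure_image_le (Nat.cast_nonneg m)).trans_lt ?_
    refine ENNReal.mul_lt_top (ENNReal.rpow_lt_top_of_nonneg (Nat.cast_nonneg m) ENNReal.coe_ne_top) ?_
    have := hausdorffMeasure_pi_real (ι := Fin m)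
    rw [Fintype.card_fin] at this
    rw [this]
    exact measure_closedBall_lt_top
  have hcover : sphere (0 : 𝔼) 1 ⊆
      ⋃ i, (ψ i 1 '' closedBall 0 1 ∪ ψ i (-1) '' closedBall 0 1) := by
    intro x hx
    have hx1 : ‖x‖ = 1 := by simpa using hx
    obtain ⟨i, -, hi⟩ := Finset.exists_max_image Finset.univ (fun i ↦ |x i|) ⟨0, by simp⟩
    have hxi : 0 < |x i| := by
      rw [abs_pos]
      intro h0
      have : x = 0 := by
        ext j
        have := hi j (Finset.mem_univ j)
        rw [h0, abs_zero] at this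
        simpa using this
      simp [this] at hx1
    have key : ∀ s : ℝ, s = x i / |x i| → x ∈ ψ i s '' closedBall 0 1 := by
      intro s hs
      refine ⟨fun k ↦ x (i.succAbove k) / |x i|, ?_, ?_⟩
      · rw [mem_closedBall, dist_zero_right, pi_norm_le_iff_of_nonneg zero_le_one]
        intro k
        rw [norm_div, norm_eq_abs, norm_eq_abs, abs_abs, div_le_one hxi]
        exact hi _ (Finset.mem_univ _)
      · have e : φ i s (fun k ↦ x (i.succAbove k) / |x i|) = |x i|⁻¹ • x := by
          ext j
          refine Fin.succAboveCases i ?_ (fun k ↦ ?_) j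
          · simp [φ, hs, div_eq_inv_mul]
          · simp [φ, div_eq_inv_mul]
        simp only [ψ]
        rw [e, norm_smul, hx1, smul_smul]
        simp [hxi.ne']
    refine mem_iUnion.2 ⟨i, ?_⟩
    rcases abs_cases (x i) with ⟨h, -⟩ | ⟨h, -⟩
    · refine Or.inl (key 1 ?_)
      rw [h, div_self (h ▸ hxi.ne')]
    · refine Or.inr (key (-1) ?_)
      rw [h, div_neg, div_self (by simpa using hxi.ne')]
  refine (measure_mono hcover).trans_lt ?_
  refine (measure_iUnion_le _).trans_lt ?_
  rw [tsum_fintype]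
  refine ENNReal.sum_lt_top.2 fun i _ ↦ (measure_union_le _ _).trans_lt ?_
  exact ENNReal.add_lt_top.2 ⟨hψ i 1 (by simp), hψ i (-1) (by simp)⟩

theorem hausdorffMeasure_unitSphere_pos :
    0 < μH[(m : ℝ)] (sphere (0 : 𝔼) 1) := by
  let q : 𝔼 → (Fin m → ℝ) := fun x k ↦ x k.succ
  have hq_lip : LipschitzWith 1 q := by
    refine LipschitzWith.of_dist_le_mul fun y z ↦ ?_
    rw [NNReal.coe_one, one_mul]
    refine (dist_pi_le_iff dist_nonneg).2 fun j ↦ ?_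
    rw [dist_eq_norm, dist_eq_norm]
    exact PiLp.norm_apply_le (y - z) j.succ
  have hsub : ball (0 : Fin m → ℝ) (1 / (m + 1)) ⊆
      q '' sphere (0 : 𝔼) 1 := by
    intro y hy
    have hy' : ∀ k, y k ^ 2 ≤ 1 / (m + 1) := fun k ↦ by
      have h1 : |y k| < 1 / (m + 1) := by
        have := norm_le_pi_norm y k
        rw [mem_ball, dist_zero_right] at hy
        exact lt_of_le_of_lt this hy
      have h2 : (1 : ℝ) / (m + 1) ≤ 1 := by
        rw [div_le_one (by positivity)]; linarith [Nat.cast_nonneg (α := ℝ) m]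
      rw [← sq_abs]
      nlinarith [abs_nonneg (y k)]
    have hs : ∑ k, y k ^ 2 ≤ 1 := by
      calc ∑ k, y k ^ 2 ≤ ∑ _k : Fin m, (1 : ℝ) / (m + 1) := Finset.sum_le_sum fun k _ ↦ hy' k
        _ = m / (m + 1) := by simp [div_eq_mul_inv]
        _ ≤ 1 := by rw [div_le_one (by positivity)]; linarith
    refine ⟨WithLp.toLp 2 (Fin.cons (√(1 - ∑ k, y k ^ 2)) y), ?_, ?_⟩
    · rw [mem_sphere_zero_iff_norm, EuclideanSpace.norm_eq, Fin.sum_univ_succ]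
      simp [sq_sqrt (sub_nonneg.2 hs)]
    · ext k
      simp [q]
  have h := hq_lip.hausdorffMeasure_image_le (Nat.cast_nonneg m)
    (sphere (0 : 𝔼) 1)
  rw [ENNReal.coe_one, ENNReal.one_rpow, one_mul] at h
  refine lt_of_lt_of_le ?_ ((measure_mono hsub).trans h)
  have := hausdorffMeasure_pi_real (ι := Fin m)
  rw [Fintype.card_fin] at this
  rw [this]
  exact measure_ball_pos _ _ (by positivity)

/-- The Hausdorff measure on the unit sphere is proportional to the measure induced by the
Lebesgue measure. -/
theorem exists_hausdorffMeasure_unitSphere_eq_smul_toSphere :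
    ∃ c : ENNReal, c ≠ 0 ∧ c ≠ ⊤ ∧
      (μH[(m : ℝ)] : Measure (sphere (0 : 𝔼) 1)) =
        c • (volume : Measure 𝔼).toSphere := by
  set μ : Measure (sphere (0 : 𝔼) 1) := μH[(m : ℝ)]
  set ν := (volume : Measure 𝔼).toSphere
  have hval : ∀ s : Set (sphere (0 : 𝔼) 1), μ s = μH[(m : ℝ)] (Subtype.val '' s) := fun s ↦
    (isometry_subtype_coe.hausdorffMeasure_image (Or.inl (Nat.cast_nonneg m)) s).symm
  have huniv : μ univ = μH[(m : ℝ)] (sphere (0 : 𝔼) 1) := by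
    rw [hval, image_univ, Subtype.range_coe]
  have : IsFiniteMeasure μ := ⟨by rw [huniv]; exact hausdorffMeasure_unitSphere_lt_top⟩
  have hball : ∀ x y : sphere (0 : 𝔼) 1, ∃ R : 𝔼 ≃ₗᵢ[ℝ] 𝔼, ∀ r,
      R '' (Subtype.val '' ball x r) = Subtype.val '' ball y r := fun x y ↦ by
    refine ⟨Submodule.reflection (ℝ ∙ (x.1 - y.1))ᗮ, fun r ↦ ?_⟩
    have hxy : Submodule.reflection (ℝ ∙ (x.1 - y.1))ᗮ x.1 = y.1 :=
      Submodule.reflection_sub (by simp)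
    generalize Submodule.reflection (ℝ ∙ (x.1 - y.1))ᗮ = R at hxy
    have e : ∀ z : sphere (0 : 𝔼) 1, Subtype.val '' ball z r = sphere (0 : 𝔼) 1 ∩ ball z.1 r := by
      intro z
      ext w
      simp [and_comm]
    rw [e, e, image_inter R.injective, R.image_sphere, R.image_ball, map_zero, hxy]
  have hμ : ∀ x y r, μ.real (ball x r) = μ.real (ball y r) := fun x y r ↦ by
    obtain ⟨R, hR⟩ := hball x y
    rw [measureReal_def, measureReal_def, hval, hval, ← hR]
    rw [show (R : 𝔼 → 𝔼) = R.toIsometryEquiv from rfl, IsometryEquiv.hausdorffMeasure_image]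
  have hν : ∀ x y r, ν.real (ball x r) = ν.real (ball y r) := fun x y r ↦ by
    obtain ⟨R, hR⟩ := hball x y
    rw [measureReal_def, measureReal_def, Measure.toSphere_apply' _ measurableSet_ball,
      Measure.toSphere_apply' _ measurableSet_ball, ← hR]
    have : Ioo (0 : ℝ) 1 • (R '' (Subtype.val '' ball x r)) =
        R '' (Ioo (0 : ℝ) 1 • (Subtype.val '' ball x r)) := by
      ext z
      simp only [mem_smul, mem_image]
      constructor
      · rintro ⟨t, ht, _, ⟨w, hw, rfl⟩, rfl⟩
        exact ⟨t • w, ⟨t, ht, w, hw, rfl⟩, by simp⟩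
      · rintro ⟨_, ⟨t, ht, w, hw, rfl⟩, rfl⟩
        exact ⟨t, ht, _, ⟨w, hw, rfl⟩, by simp⟩
    rw [this, show (R : 𝔼 → 𝔼) = R.toMeasurableEquiv from rfl, MeasurableEquiv.image_eq_preimage_symm]
    congr 2
    exact (R.symm.measurePreserving.measure_preimage_equiv _).symm
  have hmain := measure_smul_eq_of_uniform_ball μ ν hμ hν
  have hν0 : ν univ ≠ 0 := by
    simpa [ν] using (measure_ball_pos volume (0 : 𝔼) one_pos).ne'
  have hνt : ν univ ≠ ⊤ := measure_ne_top _ _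
  refine ⟨(ν univ)⁻¹ * μ univ, mul_ne_zero (ENNReal.inv_ne_zero.2 hνt) ?_,
    ENNReal.mul_ne_top (ENNReal.inv_ne_top.2 hν0) (measure_ne_top _ _), ?_⟩
  · rw [huniv]
    exact hausdorffMeasure_unitSphere_pos.ne'
  · rw [mul_smul, ← hmain, smul_smul, ENNReal.inv_mul_cancel hν0 hνt, one_smul]

/-- Integration in polar coordinates, with spherical slices measured by the Hausdorff measure. -/
theorem exists_polar_hausdorffMeasure :
    ∃ c : ENNReal, c ≠ 0 ∧ c ≠ ⊤ ∧
      ∀ (A : Set 𝔼) (g : ℝ → ENNReal), MeasurableSet A →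
        Measurable g → c * ∫⁻ x in A, g ‖x‖ =
          ∫⁻ t in Ioi (0 : ℝ), g t * μH[(m : ℝ)] (A ∩ sphere 0 t) := by
  obtain ⟨c, hc0, hct, hc⟩ := exists_hausdorffMeasure_unitSphere_eq_smul_toSphere (m := m)
  refine ⟨c, hc0, hct, fun A g hA hg ↦ ?_⟩
  set F : 𝔼 → ENNReal := A.indicator fun x ↦ g ‖x‖ with hF
  have hFm : Measurable F := (hg.comp measurable_norm).indicator hA
  have hslice : ∀ t : ℝ, 0 < t → μH[(m : ℝ)] (A ∩ sphere 0 t) = ENNReal.ofReal (t ^ m) *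
      (c * (volume : Measure 𝔼).toSphere {θ | t • θ.1 ∈ A}) := fun t ht ↦ by
    have h1 : A ∩ sphere 0 t = t • (Subtype.val '' {θ : sphere (0 : 𝔼) 1 | t • θ.1 ∈ A}) := by
      ext x
      simp only [mem_inter_iff, mem_sphere_zero_iff_norm, mem_smul_set, mem_image, mem_ofPred_eq,
        Subtype.exists, exists_and_right, exists_eq_right]
      constructor
      · rintro ⟨hx, hxt⟩
        refine ⟨t⁻¹ • x, ⟨by simp [norm_smul, hxt, abs_of_pos ht, ht.ne'], ?_⟩, ?_⟩
        · simpa [smul_smul, ht.ne'] using hx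
        · simp [smul_smul, ht.ne']
      · rintro ⟨y, ⟨hy, hyA⟩, rfl⟩
        exact ⟨hyA, by simp [norm_smul, hy, abs_of_pos ht]⟩
    rw [h1, Measure.hausdorffMeasure_smul₀ (Nat.cast_nonneg m) ht.ne',
      isometry_subtype_coe.hausdorffMeasure_image (Or.inl (Nat.cast_nonneg m)), hc,
      Measure.smul_apply, ENNReal.smul_def, smul_eq_mul, smul_eq_mul]
    congr 1
    rw [NNReal.rpow_natCast, ENNReal.ofReal, Real.toNNReal_pow ht.le]
    congr 2
    exact (Real.nnnorm_of_nonneg ht.le).trans (Real.toNNReal_of_nonneg ht.le).symm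
  have hpolar : ∫⁻ x, F x = ∫⁻ t : Ioi (0 : ℝ), ∫⁻ θ : sphere (0 : 𝔼) 1, F (t.1 • θ.1)
      ∂(volume : Measure 𝔼).toSphere ∂(Measure.volumeIoiPow m) := by
    have hmp := (volume : Measure 𝔼).measurePreserving_homeomorphUnitSphereProd
    have hfin : Module.finrank ℝ 𝔼 - 1 = m := by simp
    rw [hfin] at hmp
    have hG : Measurable fun p : sphere (0 : 𝔼) 1 × Ioi (0 : ℝ) ↦ F (p.2.1 • p.1.1) := by
      apply hFm.comp
      fun_prop
    rw [← lintegral_prod_symm _ hG.aemeasurable, ← hmp.lintegral_comp hG]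
    have hE : ∀ x : ({0}ᶜ : Set 𝔼), F (((homeomorphUnitSphereProd 𝔼) x).2.1 •
        ((homeomorphUnitSphereProd 𝔼) x).1.1) = F x := fun x ↦ by
      have : ‖x.1‖ ≠ 0 := norm_ne_zero_iff.2 x.2
      simp [smul_smul, this]
    simp_rw [hE]
    rw [lintegral_subtype_comap (measurableSet_singleton _).compl, restrict_compl_singleton]
  have hm2 : Measurable fun t : Ioi (0 : ℝ) ↦ ∫⁻ θ : sphere (0 : 𝔼) 1, F (t.1 • θ.1)
      ∂(volume : Measure 𝔼).toSphere := by
    apply Measurable.lintegral_prod_right'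
      (f := fun p : Ioi (0 : ℝ) × sphere (0 : 𝔼) 1 ↦ F (p.1.1 • p.2.1))
    apply hFm.comp
    fun_prop
  rw [← lintegral_indicator hA, hpolar, Measure.volumeIoiPow,
    lintegral_withDensity_eq_lintegral_mul _ (by fun_prop) hm2,
    ← lintegral_const_mul' _ _ hct, ← lintegral_subtype_comap measurableSet_Ioi]
  congr 1 with t
  have ht : 0 < t.1 := t.2
  have hinner : ∫⁻ θ : sphere (0 : 𝔼) 1, F (t.1 • θ.1) ∂(volume : Measure 𝔼).toSphere =
      g t.1 * (volume : Measure 𝔼).toSphere {θ | t.1 • θ.1 ∈ A} := by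
    have hms : MeasurableSet {θ : sphere (0 : 𝔼) 1 | t.1 • θ.1 ∈ A} :=
      hA.preimage (by fun_prop)
    rw [← setLIntegral_const, ← lintegral_indicator hms]
    congr 1 with θ
    have : ‖θ.1‖ = 1 := by simp
    simp [hF, indicator, norm_smul, abs_of_pos ht]
  rw [hslice t ht, Pi.mul_apply, hinner]
  ring

end SphereMeasure

section ConvexBoundary

variable {F : Type*} [NormedAddCommGroup F] [InnerProductSpace ℝ F] {Ω : Set F} {d t : ℝ}

theorem hausdorffMeasure_inter_sphere_le [MeasurableSpace F] [BorelSpace F] (hd : 0 ≤ d)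
    (hbd : IsBounded Ω) (hop : IsOpen Ω) (ht : 0 < t) :
    μH[d] (Ω ∩ sphere 0 t) ≤ μH[d] (frontier Ω ∩ {x | t ≤ ‖x‖}) := by
  refine hausdorffMeasure_le_of_nearest hd (K := closedBall 0 t)
    (inter_subset_right.trans sphere_subset_closedBall) fun x ⟨hx, hxt⟩ ↦ ?_
  rw [mem_sphere_zero_iff_norm] at hxt
  obtain ⟨k, hk, hkf⟩ : ∃ k : ℝ, 1 ≤ k ∧ k • x ∈ frontier Ω := by
    by_contra! hcon
    have hsub : (fun k : ℝ ↦ k • x) '' Ici 1 ⊆ Ω := by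
      refine (isPreconnected_Ici.image _ (by fun_prop)).subset_of_closure_inter_subset hop
        ⟨x, ⟨1, by simp, by simp⟩, hx⟩ ?_
      rintro _ ⟨hy, k, hk, rfl⟩
      by_contra hkΩ
      exact hcon k hk (by rw [hop.frontier_eq]; exact ⟨hy, hkΩ⟩)
    obtain ⟨C, hC⟩ := isBounded_iff_forall_norm_le.1 hbd
    have hC0 : 0 ≤ C := (norm_nonneg _).trans (hC x hx)
    have h1 := hC _ (hsub ⟨C / t + 1, by simp only [mem_Ici]; linarith [div_nonneg hC0 ht.le], rfl⟩)
    rw [norm_smul, hxt, norm_eq_abs, abs_of_nonneg (by positivity), add_mul,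
      div_mul_cancel₀ _ ht.ne'] at h1
    linarith
  refine ⟨k • x, ⟨hkf, ?_⟩, fun w hw ↦ ?_⟩
  · rw [mem_ofPred_eq, norm_smul, hxt, norm_eq_abs, abs_of_pos (by linarith)]
    nlinarith
  · rw [mem_closedBall_zero_iff] at hw
    have e : k • x - x = (k - 1) • x := by rw [sub_smul, one_smul]
    rw [e, inner_smul_left, inner_sub_right, real_inner_self_eq_norm_sq, hxt]
    have h1 := real_inner_le_norm x w
    rw [hxt] at h1
    refine mul_nonpos_of_nonneg_of_nonpos (by simpa using hk) ?_
    nlinarith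

theorem exists_nonneg_norm_add_smul_eq {x v : F} (hv : v ≠ 0) (hx : ‖x‖ ≤ t) :
    ∃ s : ℝ, 0 ≤ s ∧ ‖x + s • v‖ = t := by
  have hv0 : 0 < ‖v‖ := norm_pos_iff.2 hv
  have ht : 0 ≤ t := (norm_nonneg x).trans hx
  have hmem : t ∈ Icc ‖x + (0 : ℝ) • v‖ ‖x + (2 * t / ‖v‖) • v‖ := by
    refine ⟨by simpa using hx, ?_⟩
    have h1 : ‖(2 * t / ‖v‖) • v‖ = 2 * t := by
      rw [norm_smul, norm_eq_abs, abs_of_nonneg (by positivity), div_mul_cancel₀ _ hv0.ne']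
    have h2 := norm_sub_norm_le ((2 * t / ‖v‖) • v) (-x)
    rw [norm_neg, sub_neg_eq_add, add_comm _ x, h1] at h2
    linarith
  obtain ⟨s, hs, hst⟩ := intermediate_value_Icc (f := fun s : ℝ ↦ ‖x + s • v‖)
    (by positivity : 0 ≤ 2 * t / ‖v‖) (by fun_prop) hmem
  exact ⟨s, hs.1, hst⟩

theorem hausdorffMeasure_frontier_inter_ball_le [MeasurableSpace F] [BorelSpace F]
    [CompleteSpace F] (hd : 0 ≤ d) (hop : IsOpen Ω) (hconv : Convex ℝ Ω) :
    μH[d] (frontier Ω ∩ ball 0 t) ≤ μH[d] (sphere 0 t \ Ω) := by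
  refine hausdorffMeasure_le_of_nearest hd (K := closure Ω)
    (inter_subset_left.trans frontier_subset_closure) fun x ⟨hx, hxt⟩ ↦ ?_
  rw [mem_ball_zero_iff] at hxt
  rw [hop.frontier_eq] at hx
  obtain ⟨f, hf⟩ := geometric_hahn_banach_open_point hconv hop hx.2
  set v := (InnerProductSpace.toDual ℝ F).symm f with hv
  have hfv : ∀ y, f y = inner ℝ v y := fun y ↦ by simp [hv]
  have hcl : ∀ w ∈ closure Ω, inner ℝ v (w - x) ≤ 0 := by
    have hclosed : IsClosed {w | inner ℝ v (w - x) ≤ 0} :=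
      isClosed_le (by fun_prop) continuous_const
    have hsub : Ω ⊆ {w | inner ℝ v (w - x) ≤ 0} := fun w hw ↦ by
      have := hf w hw
      rw [hfv, hfv] at this
      rw [mem_ofPred_eq, inner_sub_right]
      linarith
    exact fun w hw ↦ closure_minimal hsub hclosed hw
  have hv0 : v ≠ 0 := by
    obtain ⟨w, hw⟩ := closure_nonempty_iff.1 ⟨x, hx.1⟩
    intro h0
    have := hf w hw
    rw [hfv, hfv, h0] at this
    simp at this
  obtain ⟨s, hs, hst⟩ := exists_nonneg_norm_add_smul_eq hv0 hxt.le
  refine ⟨x + s • v, ⟨by simpa using hst, fun hmem ↦ ?_⟩, fun w hw ↦ ?_⟩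
  · have := hf _ hmem
    rw [hfv, hfv, inner_add_right, inner_smul_right, real_inner_self_eq_norm_sq] at this
    nlinarith [mul_nonneg hs (sq_nonneg ‖v‖)]
  · rw [add_sub_cancel_left, inner_smul_left]
    exact mul_nonpos_of_nonneg_of_nonpos hs (hcl w hw)

end ConvexBoundary

section BoundaryMomentum

variable {m : ℕ} {Ω : Set (EuclideanSpace ℝ (Fin (m + 1)))} {r : ℝ}

local notation "𝔼" => EuclideanSpace ℝ (Fin (m + 1))

theorem hausdorffMeasure_sphere_lt_top (hr : 0 < r) :
    μH[(m : ℝ)] (sphere (0 : 𝔼) r) < ⊤ := by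
  have h := Measure.hausdorffMeasure_smul₀ (𝕜 := ℝ) (Nat.cast_nonneg m) hr.ne' (sphere (0 : 𝔼) 1)
  rw [smul_sphere' hr.ne', smul_zero, norm_of_nonneg hr.le, mul_one] at h
  rw [h, ENNReal.smul_def, smul_eq_mul]
  exact ENNReal.mul_lt_top ENNReal.coe_lt_top hausdorffMeasure_unitSphere_lt_top

theorem hausdorffMeasure_sphere_pos (hr : 0 < r) :
    0 < μH[(m : ℝ)] (sphere (0 : 𝔼) r) := by
  have h := Measure.hausdorffMeasure_smul₀ (𝕜 := ℝ) (Nat.cast_nonneg m) hr.ne' (sphere (0 : 𝔼) 1)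
  rw [smul_sphere' hr.ne', smul_zero, norm_of_nonneg hr.le, mul_one] at h
  rw [h, ENNReal.smul_def, smul_eq_mul]
  refine ENNReal.mul_pos ?_ hausdorffMeasure_unitSphere_pos.ne'
  have : ‖r‖₊ ≠ 0 := by simpa using hr.ne'
  simp [NNReal.rpow_natCast, this]

theorem exists_frontier_subset_ball (hbd : IsBounded Ω) :
    ∃ T > 0, frontier Ω ⊆ ball 0 T := by
  obtain ⟨T, hT⟩ := hbd.closure.subset_ball_lt 0 0
  exact ⟨T, hT.1, frontier_subset_closure.trans hT.2⟩

theorem hausdorffMeasure_frontier_lt_top (hbd : IsBounded Ω) (hop : IsOpen Ω)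
    (hconv : Convex ℝ Ω) : μH[(m : ℝ)] (frontier Ω) < ⊤ := by
  obtain ⟨T, hT0, hT⟩ := exists_frontier_subset_ball hbd
  have h := hausdorffMeasure_frontier_inter_ball_le (t := T) (Nat.cast_nonneg m) hop hconv
  rw [inter_eq_left.2 hT] at h
  exact (h.trans (measure_mono sdiff_subset)).trans_lt (hausdorffMeasure_sphere_lt_top hT0)

/-- The boundary momentum dominates the momentum of the same surface area placed at distance `r`,
up to the volume discrepancy between `Ω` and the ball of radius `r`. -/
theorem exists_boundary_momentum_comparison (hbd : IsBounded Ω) (hop : IsOpen Ω)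
    (hconv : Convex ℝ Ω) (hr : 0 < r) :
    ∃ c : ENNReal, c ≠ 0 ∧ c ≠ ⊤ ∧
      ENNReal.ofReal (r ^ 2) * μH[(m : ℝ)] (frontier Ω)
          + c * ∫⁻ x in Ω \ ball 0 r, ENNReal.ofReal (2 * ‖x‖) ≤
        (∫⁻ x in frontier Ω, ENNReal.ofReal (‖x‖ ^ 2) ∂μH[(m : ℝ)])
          + c * ∫⁻ x in ball 0 r \ Ω, ENNReal.ofReal (2 * ‖x‖) := by
  obtain ⟨c, hc0, hct, hc⟩ := exists_polar_hausdorffMeasure (m := m)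
  refine ⟨c, hc0, hct, ?_⟩
  have hg : Measurable fun t : ℝ ↦ ENNReal.ofReal (2 * t) := by fun_prop
  have hgnn : ∀ᵐ t ∂volume.restrict (Ioi (0 : ℝ)), 0 ≤ 2 * t := by
    filter_upwards [ae_restrict_mem measurableSet_Ioi] with t ht
    exact mul_nonneg zero_le_two (le_of_lt ht)
  have hgint : ∀ t > 0, IntervalIntegrable (fun t : ℝ ↦ 2 * t) volume 0 t := fun t _ ↦
    Continuous.intervalIntegrable (by fun_prop) _ _
  have hprim : ∀ s : ℝ, ∫ t in (0 : ℝ)..s, 2 * t = s ^ 2 := fun s ↦ by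
    rw [intervalIntegral.integral_const_mul, integral_id]; ring
  rw [hc _ (fun t ↦ ENNReal.ofReal (2 * t)) (hop.measurableSet.diff measurableSet_ball) hg,
    hc _ (fun t ↦ ENNReal.ofReal (2 * t)) (measurableSet_ball.diff hop.measurableSet) hg]
  have hP := lintegral_comp_eq_lintegral_meas_lt_mul
    ((μH[(m : ℝ)] : Measure 𝔼).restrict (frontier Ω)) (f := fun _ ↦ r)
    (.of_forall fun _ ↦ hr.le) aemeasurable_const hgint hgnn
  have hW := lintegral_comp_eq_lintegral_meas_le_mul
    ((μH[(m : ℝ)] : Measure 𝔼).restrict (frontier Ω)) (f := fun x ↦ ‖x‖)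
    (.of_forall fun _ ↦ norm_nonneg _) (by fun_prop) hgint hgnn
  simp only [hprim] at hP hW
  rw [setLIntegral_const] at hP
  rw [hP, hW]
  have hmono : Antitone fun t : ℝ ↦
      (μH[(m : ℝ)] : Measure 𝔼).restrict (frontier Ω) {x | t ≤ ‖x‖} :=
    fun s t hst ↦ measure_mono fun x hx ↦ hst.trans hx
  have hmeas := hmono.measurable.mul hg
  simp only [Pi.mul_def] at hmeas
  rw [← lintegral_add_left hmeas]
  refine (le_lintegral_add _ _).trans (setLIntegral_mono' measurableSet_Ioi fun t ht ↦ ?_)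
  have hset : MeasurableSet {x : 𝔼 | t ≤ ‖x‖} := measurableSet_le measurable_const measurable_norm
  rw [Measure.restrict_apply hset, mul_comm (ENNReal.ofReal (2 * t)),
    mul_comm (ENNReal.ofReal (2 * t)), ← add_mul, ← add_mul]
  gcongr ?_ * _
  rcases lt_or_ge t r with htr | htr
  · have h1 : (Ω \ ball 0 r) ∩ sphere 0 t = ∅ := by
      ext x
      simp only [mem_inter_iff, mem_sdiff, mem_ball_zero_iff, mem_sphere_zero_iff_norm,
        mem_empty_iff_false, iff_false]
      rintro ⟨⟨-, h⟩, rfl⟩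
      exact h htr
    have h2 : (ball 0 r \ Ω) ∩ sphere 0 t = sphere 0 t \ Ω := by
      ext x
      simp only [mem_inter_iff, mem_sdiff, mem_ball_zero_iff, mem_sphere_zero_iff_norm]
      constructor
      · rintro ⟨⟨-, h⟩, h'⟩
        exact ⟨h', h⟩
      · rintro ⟨h', h⟩
        exact ⟨⟨h' ▸ htr, h⟩, h'⟩
    rw [h1, h2, measure_empty, add_zero, show {_a : 𝔼 | t < r} = univ by simp [htr],
      Measure.restrict_apply_univ]
    have h3 : frontier Ω ⊆ ({x | t ≤ ‖x‖} ∩ frontier Ω) ∪ (frontier Ω ∩ ball 0 t) := by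
      intro x hx
      rcases le_or_gt t ‖x‖ with h | h
      · exact Or.inl ⟨h, hx⟩
      · exact Or.inr ⟨hx, by simpa using h⟩
    refine (measure_mono h3).trans ((measure_union_le _ _).trans ?_)
    exact add_le_add le_rfl
      (hausdorffMeasure_frontier_inter_ball_le (Nat.cast_nonneg m) hop hconv)
  · rw [show {_a : 𝔼 | t < r} = ∅ by simp [not_lt.2 htr], measure_empty, zero_add, inter_comm {x | _}]
    refine le_trans ?_ le_self_add
    exact (measure_mono (by gcongr; exact sdiff_subset)).trans
      (hausdorffMeasure_inter_sphere_le (Nat.cast_nonneg m) hbd hop ht)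

/-- Rigidity: an open convex set whose boundary momentum is that of a centered ball with the same
volume, with surface area factored out, is this ball. -/
theorem eq_ball_of_boundary_momentum_eq (hbd : IsBounded Ω) (hop : IsOpen Ω)
    (hconv : Convex ℝ Ω) (hne : Ω.Nonempty) (hr : 0 < r)
    (hvol : volume Ω = volume (ball (0 : 𝔼) r))
    (hW : ∫⁻ x in frontier Ω, ENNReal.ofReal (‖x‖ ^ 2) ∂μH[(m : ℝ)] =
      ENNReal.ofReal (r ^ 2) * μH[(m : ℝ)] (frontier Ω)) :
    Ω = ball 0 r := by
  obtain ⟨c, hc0, hct, hc⟩ := exists_boundary_momentum_comparison hbd hop hconv hr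
  have hP := hausdorffMeasure_frontier_lt_top hbd hop hconv
  have hle := (ENNReal.mul_le_mul_iff_right hc0 hct).1 <| (ENNReal.add_le_add_iff_left
    (ENNReal.mul_lt_top ENNReal.ofReal_lt_top hP).ne).1 (hW ▸ hc)
  have hdiff : volume (Ω \ ball 0 r) = volume (ball 0 r \ Ω) := by
    have h1 := measure_inter_add_sdiff (μ := volume) Ω (measurableSet_ball (x := (0 : 𝔼)) (ε := r))
    have h2 := measure_inter_add_sdiff (μ := volume) (ball (0 : 𝔼) r) hop.measurableSet
    rw [inter_comm, ← hvol, ← h1, inter_comm] at h2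
    exact ((ENNReal.add_right_inj
      ((measure_mono inter_subset_left).trans_lt measure_ball_lt_top).ne).1 h2).symm
  have hfin : volume (ball (0 : 𝔼) r \ Ω) ≠ ⊤ :=
    ((measure_mono sdiff_subset).trans_lt measure_ball_lt_top).ne
  have hball0 : volume (ball (0 : 𝔼) r \ Ω) = 0 := by
    by_contra hne0
    have hlt : ∫⁻ x in ball 0 r \ Ω, ENNReal.ofReal (2 * ‖x‖) <
        ∫⁻ _x in ball (0 : 𝔼) r \ Ω, ENNReal.ofReal (2 * r) := by
      refine setLIntegral_strict_mono (measurableSet_ball.diff hop.measurableSet) hne0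
        measurable_const ?_ (.of_forall fun x hx ↦ ?_)
      · refine ne_top_of_le_ne_top (ENNReal.mul_ne_top ENNReal.ofReal_ne_top hfin :
          ENNReal.ofReal (2 * r) * volume (ball (0 : 𝔼) r \ Ω) ≠ ⊤) ?_
        rw [← setLIntegral_const]
        refine setLIntegral_mono' (measurableSet_ball.diff hop.measurableSet) fun x hx ↦ ?_
        have := mem_ball_zero_iff.1 hx.1
        gcongr
      · have := mem_ball_zero_iff.1 hx.1
        exact (ENNReal.ofReal_lt_ofReal_iff (by positivity)).2 (by linarith)
    have hge : ∫⁻ _x in Ω \ ball (0 : 𝔼) r, ENNReal.ofReal (2 * r) ≤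
        ∫⁻ x in Ω \ ball 0 r, ENNReal.ofReal (2 * ‖x‖) := by
      refine setLIntegral_mono' (hop.measurableSet.diff measurableSet_ball) fun x hx ↦ ?_
      have : r ≤ ‖x‖ := by simpa using hx.2
      gcongr
    rw [setLIntegral_const, hdiff, ← setLIntegral_const] at hge
    exact (hge.trans hle).not_gt hlt
  have hΩ0 : volume (Ω \ ball (0 : 𝔼) r) = 0 := hdiff.trans hball0
  have hint : interior (closure Ω) = Ω := by
    rw [hconv.interior_closure_eq_interior_of_nonempty_interior (by rwa [hop.interior_eq]),
      hop.interior_eq]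
  have hopen : ∀ U V : Set 𝔼, IsOpen U → volume (U \ V) = 0 → U ⊆ interior (closure V) := by
    intro U V hU h0
    refine interior_maximal ?_ hU
    have : U \ closure V = ∅ := by
      by_contra hn
      exact (hU.sdiff isClosed_closure).measure_ne_zero volume (nonempty_iff_ne_empty.2 hn)
        (measure_mono_null (sdiff_subset_sdiff_right subset_closure) h0)
    exact sdiff_eq_empty.1 this
  refine Subset.antisymm ?_ ?_
  · have := hopen _ _ hop hΩ0
    rwa [closure_ball _ hr.ne', interior_closedBall _ hr.ne'] at this
  · have := hopen _ _ isOpen_ball hball0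
    rwa [hint] at this

end BoundaryMomentum

/-- `λ(Ω) = ω_n^{-2/n}` if and only if `Ω` is an open ball centered at the origin. -/
theorem lam_eq_iff_ball (n : ℕ) (hn : 2 ≤ n) (Ω : Set (EuclideanSpace ℝ (Fin n)))
    (hbd : IsBounded Ω) (hop : IsOpen Ω) (hconv : Convex ℝ Ω)
    (hint : (interior Ω).Nonempty) :
    lamFun n Ω = unitBallVol n ^ (-(2 : ℝ) / n) ↔
      ∃ r : ℝ, 0 < r ∧ Ω = ball (0 : EuclideanSpace ℝ (Fin n)) r := by
  obtain ⟨m, rfl⟩ : ∃ m, n = m + 1 := ⟨n - 1, by omega⟩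
  rw [hop.interior_eq] at hint
  have hm : ((m + 1 : ℕ) : ℝ) - 1 = m := by push_cast; ring
  have hω : 0 < unitBallVol (m + 1) :=
    ENNReal.toReal_pos (measure_ball_pos _ _ one_pos).ne' measure_ball_lt_top.ne
  have hvolball : ∀ s : ℝ, 0 ≤ s → vol (m + 1) (ball 0 s) = s ^ (m + 1) * unitBallVol (m + 1) := by
    intro s hs
    rw [vol, unitBallVol, Measure.addHaar_ball _ _ hs, ENNReal.toReal_mul,
      ENNReal.toReal_ofReal (by positivity)]
    simp
  have hscale : ∀ s : ℝ, 0 < s → (s ^ (m + 1) * unitBallVol (m + 1)) ^ ((2 : ℝ) / (m + 1 : ℕ)) =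
      s ^ 2 * unitBallVol (m + 1) ^ ((2 : ℝ) / (m + 1 : ℕ)) := by
    intro s hs
    rw [mul_rpow (by positivity) hω.le, ← rpow_natCast, ← rpow_mul hs.le,
      mul_div_cancel₀ _ (by positivity), rpow_two]
  have hneg : unitBallVol (m + 1) ^ (-(2 : ℝ) / (m + 1 : ℕ)) =
      (unitBallVol (m + 1) ^ ((2 : ℝ) / (m + 1 : ℕ)))⁻¹ := by
    rw [neg_div, rpow_neg hω.le]
  have hω2 : 0 < unitBallVol (m + 1) ^ ((2 : ℝ) / (m + 1 : ℕ)) := rpow_pos_of_pos hω _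
  constructor
  · intro h
    have hvolpos : 0 < vol (m + 1) Ω :=
      ENNReal.toReal_pos (hop.measure_ne_zero _ hint) hbd.measure_lt_top.ne
    obtain ⟨r, hr, hrV⟩ : ∃ r : ℝ, 0 < r ∧ r ^ (m + 1) * unitBallVol (m + 1) = vol (m + 1) Ω := by
      refine ⟨(vol (m + 1) Ω / unitBallVol (m + 1)) ^ (((m + 1 : ℕ) : ℝ)⁻¹), by positivity, ?_⟩
      rw [rpow_inv_natCast_pow (by positivity) (by omega)]
      field_simp
    refine ⟨r, hr, eq_ball_of_boundary_momentum_eq hbd hop hconv hint hr ?_ ?_⟩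
    · rw [← ENNReal.toReal_eq_toReal_iff' hbd.measure_lt_top.ne measure_ball_lt_top.ne]
      exact (hrV.symm.trans (hvolball r hr.le).symm)
    · have hP := hausdorffMeasure_frontier_lt_top hbd hop hconv
      have hWP : bmom (m + 1) Ω = r ^ 2 * perim (m + 1) Ω := by
        rw [lamFun, ← hrV, hscale r hr, hneg] at h
        have hP0 : perim (m + 1) Ω ≠ 0 := by
          intro h0
          rw [h0, zero_mul, div_zero] at h
          exact (inv_pos.2 hω2).ne h
        field_simp at h
        linarith
      have hfinite : ∫⁻ x in frontier Ω, ENNReal.ofReal (‖x‖ ^ 2) ∂μH[(m : ℝ)] ≠ ⊤ := by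
        obtain ⟨T, hT0, hT⟩ := exists_frontier_subset_ball hbd
        refine ne_top_of_le_ne_top (ENNReal.mul_lt_top (ENNReal.ofReal_lt_top (r := T ^ 2)) hP).ne ?_
        rw [← setLIntegral_const]
        refine setLIntegral_mono' isClosed_frontier.measurableSet fun x hx ↦ ?_
        have := mem_ball_zero_iff.1 (hT hx)
        gcongr
      rw [← ENNReal.toReal_eq_toReal_iff' hfinite
        (ENNReal.mul_lt_top ENNReal.ofReal_lt_top hP).ne, ENNReal.toReal_mul,
        ENNReal.toReal_ofReal (by positivity)]
      rw [bmom, perim, hm, integral_eq_lintegral_of_nonneg_ae (.of_forall fun _ ↦ by positivity)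
        (by fun_prop)] at hWP
      exact hWP
  · rintro ⟨r, hr, rfl⟩
    have hfr : frontier (ball (0 : EuclideanSpace ℝ (Fin (m + 1))) r) = sphere 0 r :=
      frontier_ball _ hr.ne'
    have hP : 0 < perim (m + 1) (ball 0 r) := by
      rw [perim, hm, hfr]
      exact ENNReal.toReal_pos (hausdorffMeasure_sphere_pos hr).ne'
        (hausdorffMeasure_sphere_lt_top hr).ne
    have hW : bmom (m + 1) (ball 0 r) = r ^ 2 * perim (m + 1) (ball 0 r) := by
      have hcongr : EqOn (fun x : EuclideanSpace ℝ (Fin (m + 1)) ↦ ‖x‖ ^ 2) (fun _ ↦ r ^ 2)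
          (sphere 0 r) := fun x hx ↦ by simp only [mem_sphere_zero_iff_norm.1 hx]
      rw [bmom, perim, hfr, setIntegral_congr_fun isClosed_sphere.measurableSet hcongr,
        setIntegral_const, smul_eq_mul, mul_comm, measureReal_def]
    rw [lamFun, hvolball r hr.le, hscale r hr, hneg, hW]
    field_simp
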